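/- arXiv:1702.08435 — 3 statements merged into one kernel-verified Lean document; each statement's English description precedes it below -/
import Mathlib

section
/- Let P be a primitive row-stochastic matrix indexed by a finite nonempty set S. Then P has a unique stationary probability distribution: if π and ρ are probability distributions on S with π′P = π′ and ρ′P = ρ′, then π = ρ. -/
open Finset

lemma Matrix.vecMul_pow_eq_self {S R : Type*} [Fintype S] [DecidableEq S] [Semiring R]
    {A : Matrix S S R} {v : S → R} (hv : Matrix.vecMul v A = v) (m : ℕ) :
    Matrix.vecMul v (A ^ m) = v := by
  induction m with
  | zero => simp
  | succ m ih => rw [pow_succ, ← Matrix.vecMul_vecMul, ih, hv]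

lemma Matrix.eq_zero_of_vecMul_eq_self_of_pos {S : Type*} [Fintype S]
    {A : Matrix S S ℝ} (hA : ∀ i j, 0 < A i j) {v : S → ℝ} (hv0 : ∀ i, 0 ≤ v i)
    (hv : Matrix.vecMul v A = v) {s : S} (hs : v s = 0) : v = 0 := by
  have h : ∑ i, v i * A i s = 0 := (congrFun hv s).trans hs
  rw [Finset.sum_eq_zero_iff_of_nonneg fun i _ => mul_nonneg (hv0 i) (hA i s).le] at h
  funext i
  exact (mul_eq_zero.1 (h i (Finset.mem_univ i))).resolve_right (hA i s).ne'

/-- A primitive row-stochastic matrix on a finite nonempty set has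
a unique stationary probability distribution. -/
theorem stmt_5 {S : Type*} [Fintype S] [Nonempty S] [DecidableEq S]
    (P : Matrix S S ℝ)
    (hP0 : ∀ i j, 0 ≤ P i j) (hP1 : ∀ i, ∑ j, P i j = 1)
    (hprim : ∃ m : ℕ, 1 ≤ m ∧ ∀ i j, 0 < (P ^ m) i j)
    (π ρ : S → ℝ)
    (hπ0 : ∀ s, 0 ≤ π s) (hπ1 : ∑ s, π s = 1)
    (hπstat : ∀ j, ∑ i, π i * P i j = π j)
    (hρ0 : ∀ s, 0 ≤ ρ s) (hρ1 : ∑ s, ρ s = 1)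
    (hρstat : ∀ j, ∑ i, ρ i * P i j = ρ j) :
    π = ρ := by
  obtain ⟨m, -, hm⟩ := hprim
  have hπm : Matrix.vecMul π (P ^ m) = π := Matrix.vecMul_pow_eq_self (funext hπstat) m
  have hρm : Matrix.vecMul ρ (P ^ m) = ρ := Matrix.vecMul_pow_eq_self (funext hρstat) m
  have hρpos : ∀ s, 0 < ρ s := fun s => (hρ0 s).lt_of_ne' fun hs => by
    simp [Matrix.eq_zero_of_vecMul_eq_self_of_pos hm hρ0 hρm hs] at hρ1
  obtain ⟨t, ht⟩ := Finite.exists_min fun s => π s / ρ s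
  have hw : π - (π t / ρ t) • ρ = 0 := by
    refine Matrix.eq_zero_of_vecMul_eq_self_of_pos hm (fun s => ?_) ?_ (s := t) ?_
    · simpa using (le_div_iff₀ (hρpos s)).1 (ht s)
    · rw [Matrix.sub_vecMul, Matrix.smul_vecMul, hπm, hρm]
    · simp [(hρpos t).ne']
  have hπρ : π = (π t / ρ t) • ρ := sub_eq_zero.1 hw
  have hc : π t / ρ t = 1 := by
    have h : ∑ s, π s = π t / ρ t * ∑ s, ρ s := by
      rw [Finset.mul_sum]
      exact Finset.sum_congr rfl fun s _ => congrFun hπρ s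
    rw [hπ1, hρ1, mul_one] at h
    exact h.symm
  rwa [hc, one_smul] at hπρ
end

section
/- Let P be a primitive row-stochastic matrix indexed by a finite nonempty set S with stationary probability distribution π. Then for all i, j ∈ S the series ∑_{m=1}^∞ [π_i((P^m)_{ij} − π_j) + π_j((P^m)_{ji} − π_i)] converges absolutely. -/
open Finset

/-- A nonnegative sequence that contracts by a factor `r < 1` every `M` steps is summable. -/
theorem summable_of_add_le_mul {a : ℕ → ℝ} (ha : ∀ n, 0 ≤ a n) {r : ℝ} (hr : r < 1) (M : ℕ)
    (h : ∀ n, a (M + n) ≤ r * a n) : Summable a := by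
  refine summable_of_sum_range_le (c := (∑ m ∈ Finset.range M, a m) / (1 - r)) ha fun N => ?_
  rw [le_div_iff₀ (by linarith)]
  have h1 : ∑ m ∈ Finset.range N, a m ≤ ∑ m ∈ Finset.range (M + N), a m :=
    Finset.sum_le_sum_of_subset_of_nonneg (Finset.range_mono (by omega)) fun m _ _ => ha m
  have h2 : ∑ m ∈ Finset.range N, a (M + m) ≤ r * ∑ m ∈ Finset.range N, a m := by
    rw [Finset.mul_sum]
    exact Finset.sum_le_sum fun m _ => h m
  rw [Finset.sum_range_add] at h1
  linarith

/-- Doeblin's contraction: if every row of `Q` dominates `c • π`, then `Q` contracts the `ℓ¹` norm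
of row vectors of total mass zero by the factor `1 - c`. -/
theorem sum_abs_vecMul_le {S : Type*} [Fintype S] {Q : Matrix S S ℝ}
    (hQ1 : ∀ i, ∑ j, Q i j = 1) {π : S → ℝ} (hπ1 : ∑ s, π s = 1) {c : ℝ}
    (hc : ∀ i j, c * π j ≤ Q i j) {v : S → ℝ} (hv : ∑ s, v s = 0) :
    ∑ j, |∑ i, v i * Q i j| ≤ (1 - c) * ∑ i, |v i| := by
  have h1 : ∀ j, |∑ i, v i * Q i j| ≤ ∑ i, |v i| * (Q i j - c * π j) := fun j => by
    have : ∑ i, v i * Q i j = ∑ i, v i * (Q i j - c * π j) := by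
      simp only [mul_sub, Finset.sum_sub_distrib, ← Finset.sum_mul, hv, zero_mul, sub_zero]
    rw [this]
    refine (Finset.abs_sum_le_sum_abs _ _).trans_eq (Finset.sum_congr rfl fun i _ => ?_)
    rw [abs_mul, abs_of_nonneg (sub_nonneg.2 (hc i j))]
  refine (Finset.sum_le_sum fun j _ => h1 j).trans_eq ?_
  rw [Finset.sum_comm, Finset.mul_sum]
  refine Finset.sum_congr rfl fun i _ => ?_
  rw [← Finset.mul_sum, Finset.sum_sub_distrib, hQ1, ← Finset.mul_sum, hπ1]
  ring

theorem sum_pow_apply_eq_one {S : Type*} [Fintype S] [DecidableEq S] {P : Matrix S S ℝ}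
    (hP1 : ∀ i, ∑ j, P i j = 1) (m : ℕ) (i : S) : ∑ j, (P ^ m) i j = 1 := by
  induction m with
  | zero => simp [Matrix.one_apply]
  | succ m ih =>
    simp only [pow_succ, Matrix.mul_apply]
    rw [Finset.sum_comm]
    simp only [← Finset.mul_sum, hP1, mul_one, ih]

theorem sum_mul_pow_apply_eq {S : Type*} [Fintype S] [DecidableEq S] {P : Matrix S S ℝ}
    {π : S → ℝ} (hstat : ∀ j, ∑ i, π i * P i j = π j) (m : ℕ) (j : S) :
    ∑ i, π i * (P ^ m) i j = π j := by
  have h1 : Matrix.vecMul π P = π := funext hstat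
  have h2 : Matrix.vecMul π (P ^ m) = π := by
    induction m with
    | zero => simp
    | succ m ih => rw [pow_succ, ← Matrix.vecMul_vecMul, ih, h1]
  exact congrFun h2 j

/-- The `ℓ¹` distance to stationarity of a primitive chain started at `i` is summable in time. -/
theorem summable_sum_abs_pow_sub {S : Type*} [Fintype S] [Nonempty S] [DecidableEq S]
    {P : Matrix S S ℝ} (hP1 : ∀ i, ∑ j, P i j = 1) {M : ℕ} (hM : ∀ i j, 0 < (P ^ M) i j)
    {π : S → ℝ} (hπ : ∀ s, π s ≤ 1) (hπ1 : ∑ s, π s = 1)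
    (hstat : ∀ j, ∑ i, π i * P i j = π j) (i : S) :
    Summable fun m : ℕ => ∑ j, |(P ^ m) i j - π j| := by
  obtain ⟨p, hp⟩ := Finite.exists_min fun p : S × S => (P ^ M) p.1 p.2
  set c := (P ^ M) p.1 p.2
  have hc0 : 0 < c := hM _ _
  refine summable_of_add_le_mul (fun m => Finset.sum_nonneg fun j _ => abs_nonneg _)
    (r := 1 - c) (by linarith) M fun n => ?_
  have hc : ∀ k j, c * π j ≤ (P ^ M) k j := fun k j =>
    (mul_le_of_le_one_right hc0.le (hπ j)).trans (hp (k, j))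
  have hv : ∑ j, ((P ^ n) i j - π j) = 0 := by
    rw [Finset.sum_sub_distrib, sum_pow_apply_eq_one hP1, hπ1, sub_self]
  refine le_of_eq_of_le (Finset.sum_congr rfl fun j _ => ?_)
    (sum_abs_vecMul_le (sum_pow_apply_eq_one hP1 M) hπ1 hc hv)
  simp only [sub_mul, Finset.sum_sub_distrib, sum_mul_pow_apply_eq hstat, add_comm M n, pow_add,
    Matrix.mul_apply]

/-- For a primitive row-stochastic matrix `P` with stationary
probability distribution `π`, the series
`∑_{m≥1} [π_i((P^m)_{ij} − π_j) + π_j((P^m)_{ji} − π_i)]` converges absolutely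
for all `i, j`. -/
theorem stmt_7 {S : Type*} [Fintype S] [Nonempty S] [DecidableEq S]
    (P : Matrix S S ℝ)
    (hP0 : ∀ i j, 0 ≤ P i j) (hP1 : ∀ i, ∑ j, P i j = 1)
    (hprim : ∃ m : ℕ, 1 ≤ m ∧ ∀ i j, 0 < (P ^ m) i j)
    (π : S → ℝ)
    (hπ0 : ∀ s, 0 ≤ π s) (hπ1 : ∑ s, π s = 1)
    (hstat : ∀ j, ∑ i, π i * P i j = π j) :
    ∀ i j : S,
      Summable (fun m : ℕ =>
        |π i * ((P ^ (m + 1)) i j - π j) + π j * ((P ^ (m + 1)) j i - π i)|) := by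
  intro i j
  obtain ⟨M, -, hM⟩ := hprim
  have hπ : ∀ s, π s ≤ 1 := fun s =>
    hπ1 ▸ Finset.single_le_sum (fun t _ => hπ0 t) (Finset.mem_univ s)
  have hs : ∀ k, Summable fun m : ℕ => ∑ l, |(P ^ (m + 1)) k l - π l| := fun k =>
    (summable_nat_add_iff 1).2 (summable_sum_abs_pow_sub hP1 hM hπ hπ1 hstat k)
  have hb : ∀ (m : ℕ) (k l : S),
      |π k * ((P ^ m) k l - π l)| ≤ ∑ l, |(P ^ m) k l - π l| := fun m k l => by
    rw [abs_mul, abs_of_nonneg (hπ0 k)]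
    exact (mul_le_of_le_one_left (abs_nonneg _) (hπ k)).trans
      (Finset.single_le_sum (f := fun l => |(P ^ m) k l - π l|)
        (fun t _ => abs_nonneg _) (Finset.mem_univ l))
  exact ((hs i).add (hs j)).of_nonneg_of_le (fun m => abs_nonneg _) fun m =>
    (abs_add_le _ _).trans (add_le_add (hb _ i j) (hb _ j i))
end

section
/- Let Z = (Z_l)_{l≥1} be a stationary Markov chain on a probability space (Ω, 𝔪) with values in a finite set S, primitive row-stochastic transition matrix P, and stationary initial distribution π. Fix k ∈ S and define U_{n,k} = √n·((1/n)∑_{l=1}^n 1{Z_l = k} − π_k). Then σ_k² := π_k(1 − π_k) + 2∑_{m=1}^∞ π_k((P^m)_{kk} − π_k) is a convergent series, σ_k² ≥ 0, and U_{n,k} converges in distribution, as n → ∞, to the Gaussian distribution on ℝ with mean 0 and variance σ_k². -/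
open MeasureTheory ProbabilityTheory Filter Topology Finset

open Matrix in
lemma norm_mulVec_le_of_row_sum_le {S 𝕜 : Type*} [Fintype S] [RCLike 𝕜] {A : Matrix S S 𝕜}
    {c : ℝ} (hc : 0 ≤ c) (hA : ∀ i, ∑ j, ‖A i j‖ ≤ c) (v : S → 𝕜) :
    ‖A *ᵥ v‖ ≤ c * ‖v‖ := by
  refine (pi_norm_le_iff_of_nonneg (by positivity)).2 fun i => ?_
  calc ‖(A *ᵥ v) i‖ ≤ ∑ j, ‖A i j * v j‖ := norm_sum_le _ _
    _ ≤ ∑ j, ‖A i j‖ * ‖v‖ := by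
        gcongr with j
        rw [norm_mul]
        gcongr
        exact norm_le_pi_norm v j
    _ = (∑ j, ‖A i j‖) * ‖v‖ := by rw [sum_mul]
    _ ≤ c * ‖v‖ := by gcongr; exact hA i

lemma summable_of_le_mul_shift {u : ℕ → ℝ} (hu : ∀ n, 0 ≤ u n) {p : ℕ} {r : ℝ}
    (hr : r < 1) (h : ∀ n, u (n + p) ≤ r * u n) : Summable u := by
  refine summable_of_sum_range_le (c := (∑ i ∈ range p, u i) / (1 - r)) hu fun n => ?_
  rw [le_div_iff₀ (by linarith)]
  have h1 : ∑ i ∈ range n, u i ≤ ∑ i ∈ range (n + p), u i :=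
    sum_le_sum_of_subset_of_nonneg (range_mono (by omega)) fun i _ _ => hu i
  have h2 : ∑ i ∈ range (n + p), u i = ∑ i ∈ range p, u i + ∑ i ∈ range n, u (i + p) := by
    rw [add_comm n p, sum_range_add]
    simp_rw [add_comm p]
  have h3 : ∑ i ∈ range n, u (i + p) ≤ r * ∑ i ∈ range n, u i := by
    rw [mul_sum]
    exact sum_le_sum fun i _ => h i
  linarith

section Stochastic

open Matrix

variable {S : Type*} [Fintype S] [DecidableEq S] {P : Matrix S S ℝ} {π : S → ℝ}

lemma vecMul_pow_of_stationary (hstat : π ᵥ* P = π) (n : ℕ) : π ᵥ* P ^ n = π := by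
  induction n with
  | zero => simp
  | succ n ih => rw [pow_succ, ← vecMul_vecMul, ih, hstat]

lemma exists_norm_pow_mulVec_le_of_primitive (hP : P ∈ rowStochastic ℝ S)
    (hprim : ∃ m : ℕ, 1 ≤ m ∧ ∀ i j, 0 < (P ^ m) i j)
    (hπ0 : ∀ s, 0 ≤ π s) (hπ1 : ∑ s, π s = 1) :
    ∃ (p : ℕ) (r : ℝ), r < 1 ∧
      ∀ v : S → ℝ, π ⬝ᵥ v = 0 → ‖(P ^ p) *ᵥ v‖ ≤ r * ‖v‖ := by
  obtain ⟨p, -, hp⟩ := hprim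
  have hne : Nonempty S := by
    by_contra h
    rw [not_nonempty_iff] at h
    simp at hπ1
  obtain ⟨⟨i₀, j₀⟩, hmin⟩ := Finite.exists_min fun x : S × S => (P ^ p) x.1 x.2
  set ε := (P ^ p) i₀ j₀
  have hPp := pow_mem hP p
  have hε1 : ε ≤ 1 := le_one_of_mem_rowStochastic hPp
  have hπ_le (j : S) : π j ≤ 1 := hπ1 ▸ single_le_sum (fun s _ => hπ0 s) (mem_univ j)
  refine ⟨p, 1 - ε, by linarith [hp i₀ j₀], fun v hv => ?_⟩
  have hsub : (P ^ p) *ᵥ v = (Matrix.of fun i j => (P ^ p) i j - ε * π j) *ᵥ v := by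
    ext i
    have : ∑ j, ε * π j * v j = 0 := by
      simp_rw [mul_assoc, ← mul_sum]
      exact mul_eq_zero_of_right _ hv
    simp [mulVec, dotProduct, sub_mul, sum_sub_distrib, this]
  rw [hsub]
  refine norm_mulVec_le_of_row_sum_le (by linarith) (fun i => le_of_eq ?_) v
  have hnn (j : S) : 0 ≤ (P ^ p) i j - ε * π j := by
    have := hmin (i, j)
    nlinarith [hp i₀ j₀, hπ_le j]
  simp only [of_apply, Real.norm_eq_abs, abs_of_nonneg (hnn _)]
  rw [sum_sub_distrib, ← mul_sum, hπ1, sum_row_of_mem_rowStochastic hPp, mul_one]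

lemma summable_pow_mulVec_of_primitive (hP : P ∈ rowStochastic ℝ S)
    (hprim : ∃ m : ℕ, 1 ≤ m ∧ ∀ i j, 0 < (P ^ m) i j)
    (hπ0 : ∀ s, 0 ≤ π s) (hπ1 : ∑ s, π s = 1) (hstat : π ᵥ* P = π)
    {v : S → ℝ} (hv : π ⬝ᵥ v = 0) : Summable fun m : ℕ => (P ^ m) *ᵥ v := by
  obtain ⟨p, r, hr1, h⟩ := exists_norm_pow_mulVec_le_of_primitive hP hprim hπ0 hπ1
  refine Summable.of_norm (summable_of_le_mul_shift (fun _ => norm_nonneg _) hr1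
    (p := p) fun n => ?_)
  rw [add_comm n p, pow_add, ← mulVec_mulVec]
  exact h _ (by rw [dotProduct_mulVec, vecMul_pow_of_stationary hstat, hv])

lemma mulVec_tsum_pow_mulVec {v : S → ℝ} (h : Summable fun m : ℕ => (P ^ m) *ᵥ v) :
    P *ᵥ (∑' m : ℕ, (P ^ m) *ᵥ v) = ∑' m : ℕ, (P ^ (m + 1)) *ᵥ v := by
  have hc : Continuous fun w : S → ℝ => P *ᵥ w := by fun_prop
  have := h.hasSum.map (P.mulVecLin.toAddMonoidHom) hc
  refine (this.tsum_eq.symm.trans (tsum_congr fun m => ?_))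
  simp [pow_succ']

lemma tsum_pow_mulVec_eq_add {v : S → ℝ} (h : Summable fun m : ℕ => (P ^ m) *ᵥ v) :
    ∑' m : ℕ, (P ^ m) *ᵥ v = v + P *ᵥ (∑' m : ℕ, (P ^ m) *ᵥ v) := by
  rw [mulVec_tsum_pow_mulVec h, h.tsum_eq_zero_add]
  simp

lemma dotProduct_tsum_pow_mulVec_eq_zero (hstat : π ᵥ* P = π) {v : S → ℝ} (hv : π ⬝ᵥ v = 0)
    (h : Summable fun m : ℕ => (P ^ m) *ᵥ v) : π ⬝ᵥ (∑' m : ℕ, (P ^ m) *ᵥ v) = 0 := by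
  have h1 : HasSum (fun m : ℕ => π ⬝ᵥ ((P ^ m) *ᵥ v)) (π ⬝ᵥ (∑' m : ℕ, (P ^ m) *ᵥ v)) :=
    hasSum_sum fun s _ => (Pi.hasSum.1 h.hasSum s).mul_left (π s)
  refine h1.unique ?_
  simp [dotProduct_mulVec, vecMul_pow_of_stationary hstat, hv, hasSum_zero]

end Stochastic

section Tilted

open Matrix

variable {S : Type*} [Fintype S] [DecidableEq S] {P : Matrix S S ℝ} {π f : S → ℝ}

/-- The transition matrix `P` whose `i`-th row is twisted by the phase `exp (i θ f(i))`. -/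
noncomputable def phaseMatrix (P : Matrix S S ℝ) (f : S → ℝ) (θ : ℝ) : Matrix S S ℂ :=
  Matrix.of fun i j => Complex.exp (θ * f i * Complex.I) * P i j

lemma norm_phaseMatrix_pow_mulVec_le (hP : P ∈ rowStochastic ℝ S) (f : S → ℝ) (θ : ℝ) (n : ℕ)
    (v : S → ℂ) : ‖(phaseMatrix P f θ ^ n) *ᵥ v‖ ≤ ‖v‖ := by
  induction n with
  | zero => simp
  | succ n ih =>
    rw [pow_succ', ← mulVec_mulVec]
    refine le_trans ?_ ih
    refine (norm_mulVec_le_of_row_sum_le zero_le_one (fun i => le_of_eq ?_) _).trans_eq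
      (one_mul _)
    rw [← sum_row_of_mem_rowStochastic hP i]
    refine sum_congr rfl fun j _ => ?_
    rw [phaseMatrix, of_apply, norm_mul, ← Complex.ofReal_mul, Complex.norm_exp_ofReal_mul_I,
      one_mul, Complex.norm_real, Real.norm_of_nonneg (nonneg_of_mem_rowStochastic hP)]

lemma phaseMatrix_mulVec_apply {S : Type*} [Fintype S] (P : Matrix S S ℝ) (f : S → ℝ) (θ : ℝ) (v : S → ℂ) (i : S) :
    (phaseMatrix P f θ *ᵥ v) i = Complex.exp (θ * f i * Complex.I) * ∑ j, (P i j : ℂ) * v j := by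
  simp [phaseMatrix, mulVec, dotProduct, mul_sum, mul_assoc]

/-- Summing the phases over all paths of `n + 1` states, weighted by `P` and an initial weight `u`,
amounts to applying a power of the phase matrix. -/
lemma sum_path_eq_phaseMatrix_pow (hP : P ∈ rowStochastic ℝ S) (f : S → ℝ) (θ : ℝ) (n : ℕ)
    (u : S → ℂ) :
    ∑ s : Fin (n + 1) → S, u (s 0) * (∏ l : Fin n, (P (s l.castSucc) (s l.succ) : ℂ)) *
        ∏ l, Complex.exp (θ * f (s l) * Complex.I) =
      ∑ x, u x * ((phaseMatrix P f θ ^ (n + 1)) *ᵥ 1) x := by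
  induction n generalizing u with
  | zero =>
    rw [← (Equiv.funUnique (Fin 1) S).symm.sum_comp]
    refine sum_congr rfl fun x _ => ?_
    have h : ∑ j, (P x j : ℂ) = 1 := by
      exact_mod_cast sum_row_of_mem_rowStochastic hP x
    simp [phaseMatrix_mulVec_apply, h]
  | succ n ih =>
    have h := ih fun y => ∑ x, u x * Complex.exp (θ * f x * Complex.I) * P x y
    rw [← (Fin.consEquiv fun _ => S).sum_comp, Fintype.sum_prod_type, sum_comm]
    have hr : ∑ x, u x * ((phaseMatrix P f θ ^ (n + 1 + 1)) *ᵥ 1) x =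
        ∑ y, (∑ x, u x * Complex.exp (θ * f x * Complex.I) * P x y) *
          ((phaseMatrix P f θ ^ (n + 1)) *ᵥ 1) y := by
      simp_rw [sum_mul]
      rw [sum_comm]
      refine sum_congr rfl fun x _ => ?_
      rw [pow_succ', ← mulVec_mulVec, phaseMatrix_mulVec_apply, mul_sum, mul_sum]
      exact sum_congr rfl fun y _ => by ring
    rw [hr, ← h]
    refine sum_congr rfl fun s _ => ?_
    rw [sum_mul, sum_mul]
    refine sum_congr rfl fun x _ => ?_
    simp only [Fin.consEquiv, Equiv.coe_fn_mk, Fin.prod_univ_succ (n := n + 1),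
      Fin.prod_univ_succ (n := n), Fin.cons_zero, Fin.cons_succ, Fin.castSucc_zero,
      ← Fin.succ_castSucc]
    ring

/-- Second-order approximate eigenvector of the phase matrix. -/
noncomputable def approxEigenvector (a b : S → ℝ) (θ : ℝ) : S → ℂ :=
  fun s => 1 + θ * a s * Complex.I + θ ^ 2 * b s

lemma phaseMatrix_mulVec_approxEigenvector (hP : P ∈ rowStochastic ℝ S) (f a b : S → ℝ)
    (θ : ℝ) (i : S) :
    (phaseMatrix P f θ *ᵥ approxEigenvector a b θ) i =
      Complex.exp (θ * f i * Complex.I) *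
        (1 + θ * ((P *ᵥ a) i : ℝ) * Complex.I + θ ^ 2 * ((P *ᵥ b) i : ℝ)) := by
  rw [phaseMatrix_mulVec_apply]
  congr 1
  have h : ∑ j, (P i j : ℂ) = 1 := by
    exact_mod_cast sum_row_of_mem_rowStochastic hP i
  simp only [approxEigenvector, mulVec, dotProduct, Complex.ofReal_sum, Complex.ofReal_mul]
  simp only [mul_add, sum_add_distrib, mul_one, h, mul_sum, sum_mul]
  congr 1
  · congr 1
    exact sum_congr rfl fun j _ => by ring
  · exact sum_congr rfl fun j _ => by ring

lemma isBigO_phaseMatrix_mulVec_sub (hP : P ∈ rowStochastic ℝ S) {a b : S → ℝ} {v : ℝ}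
    (ha : ∀ s, a s = f s + (P *ᵥ a) s)
    (hb : ∀ s, b s = (P *ᵥ b) s + v / 2 - f s * (P *ᵥ a) s - f s ^ 2 / 2) :
    (fun θ : ℝ => phaseMatrix P f θ *ᵥ approxEigenvector a b θ -
      (1 - (θ : ℂ) ^ 2 * v / 2) • approxEigenvector a b θ) =O[𝓝 0] fun θ => θ ^ 3 := by
  refine Asymptotics.isBigO_pi.2 fun i => ?_
  have hlim : Tendsto (fun θ : ℝ => (θ * f i * Complex.I : ℂ)) (𝓝 0) (𝓝 0) :=
    Continuous.tendsto' (by fun_prop) _ _ (by simp)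
  have hexp := (Complex.exp_sub_sum_range_isBigO_pow 3).comp_tendsto hlim
  have hpow : ((fun x : ℂ => x ^ 3) ∘ fun θ : ℝ => (θ * f i * Complex.I : ℂ)) =O[𝓝 0]
      fun θ : ℝ => θ ^ 3 := by
    refine Asymptotics.IsBigO.of_bound (|f i| ^ 3) (Eventually.of_forall fun θ => ?_)
    simp [mul_pow, mul_comm]
  have hcont (g : ℝ → ℂ) (hg : Continuous g) : g =O[𝓝 0] fun _ : ℝ => (1 : ℝ) :=
    hg.continuousAt.isBigO_one ℝ
  set A : ℝ := (P *ᵥ a) i with hA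
  set B : ℝ := (P *ᵥ b) i with hB
  have h1 := (hexp.trans hpow).mul
    (hcont (fun θ => 1 + θ * A * Complex.I + θ ^ 2 * B) (by fun_prop))
  have hcube : (fun θ : ℝ => (θ : ℂ) ^ 3) =O[𝓝 0] fun θ : ℝ => θ ^ 3 :=
    Asymptotics.IsBigO.of_bound 1 (Eventually.of_forall fun θ => by simp)
  have h2 := hcube.mul (hcont (fun θ => f i * Complex.I * B - θ * f i ^ 2 * B / 2
    - f i ^ 2 * A * Complex.I / 2 + v / 2 * (a i * Complex.I + θ * b i)) (by fun_prop))
  simp only [mul_one] at h1 h2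
  refine (h1.add h2).congr_left fun θ => ?_
  have ha' : (a i : ℂ) = f i + A := by exact_mod_cast ha i
  have hb' : (b i : ℂ) = B + v / 2 - f i * A - f i ^ 2 / 2 := by exact_mod_cast hb i
  simp only [Pi.sub_apply, Pi.smul_apply, smul_eq_mul,
    phaseMatrix_mulVec_approxEigenvector hP, approxEigenvector, Function.comp, sum_range_succ,
    sum_range_zero, ← hA, ← hB, Nat.factorial]
  rw [ha', hb']
  push_cast
  have hI3 : Complex.I ^ 3 = -Complex.I := by
    rw [pow_succ, Complex.I_sq, neg_one_mul]
  ring_nf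
  simp only [Complex.I_sq, hI3]
  ring

lemma norm_pow_mulVec_sub_pow_smul_le {M : Matrix S S ℂ} (hM : ∀ n w, ‖(M ^ n) *ᵥ w‖ ≤ ‖w‖)
    {c : ℂ} {K : ℝ} {n : ℕ} (hc : ∀ j ≤ n, ‖c‖ ^ j ≤ K) (w : S → ℂ) :
    ‖(M ^ n) *ᵥ w - c ^ n • w‖ ≤ n * (K * ‖M *ᵥ w - c • w‖) := by
  induction n with
  | zero => simp
  | succ n ih =>
    have hs : (M ^ (n + 1)) *ᵥ w - c ^ (n + 1) • w =
        M *ᵥ ((M ^ n) *ᵥ w - c ^ n • w) + c ^ n • (M *ᵥ w - c • w) := by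
      rw [mulVec_sub, mulVec_smul, mulVec_mulVec, ← pow_succ', smul_sub, smul_smul, ← pow_succ]
      abel
    rw [hs]
    refine (norm_add_le _ _).trans ?_
    have h1 := hM 1 ((M ^ n) *ᵥ w - c ^ n • w)
    rw [pow_one] at h1
    have h2 := ih fun j hj => hc j (by omega)
    have h3 : ‖c ^ n • (M *ᵥ w - c • w)‖ ≤ K * ‖M *ᵥ w - c • w‖ := by
      rw [norm_smul, norm_pow]
      gcongr
      exact hc n (by omega)
    push_cast
    linarith

lemma tendsto_sum_phaseMatrix_pow (hP : P ∈ rowStochastic ℝ S) (hπ1 : ∑ s, π s = 1)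
    {a b : S → ℝ} {v : ℝ} (ha : ∀ s, a s = f s + (P *ᵥ a) s)
    (hb : ∀ s, b s = (P *ᵥ b) s + v / 2 - f s * (P *ᵥ a) s - f s ^ 2 / 2) (t : ℝ) :
    Tendsto (fun n : ℕ => ∑ s, (π s : ℂ) * ((phaseMatrix P f (t / √n) ^ n) *ᵥ 1) s) atTop
      (𝓝 (Complex.exp (-(v * t ^ 2 / 2)))) := by
  set h := approxEigenvector a b
  set lam : ℕ → ℂ := fun n => 1 + (-(v * t ^ 2 / 2) : ℂ) / n with hlam
  have hθ : Tendsto (fun n : ℕ => t / √n) atTop (𝓝 0) :=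
    tendsto_const_nhds.div_atTop (Real.tendsto_sqrt_atTop.comp tendsto_natCast_atTop_atTop)
  have hlamn : Tendsto (fun n => lam n ^ n) atTop (𝓝 (Complex.exp (-(v * t ^ 2 / 2)))) :=
    Complex.tendsto_one_add_div_pow_exp _
  have hh1 : Tendsto (fun n : ℕ => h (t / √n)) atTop (𝓝 1) := by
    have : Continuous h := by
      unfold h approxEigenvector
      fun_prop
    refine (this.tendsto' 0 1 ?_).comp hθ
    ext s
    simp [h, approxEigenvector]
  have hlamK (n j : ℕ) (hj : j ≤ n) : ‖lam n‖ ^ j ≤ Real.exp (|v * t ^ 2 / 2|) := by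
    have h0 : ‖lam n‖ ≤ 1 + |v * t ^ 2 / 2| / n := by
      refine (norm_add_le _ _).trans ?_
      rw [norm_one, norm_div, norm_neg, RCLike.norm_natCast]
      refine le_of_eq ?_
      congr 2
      exact_mod_cast Complex.norm_real _
    have h1 : (1 : ℝ) ≤ 1 + |v * t ^ 2 / 2| / n := by
      have : 0 ≤ |v * t ^ 2 / 2| / (n : ℝ) := by positivity
      linarith
    calc ‖lam n‖ ^ j ≤ (1 + |v * t ^ 2 / 2| / n) ^ j := by gcongr
      _ ≤ (1 + |v * t ^ 2 / 2| / n) ^ n := pow_le_pow_right₀ h1 hj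
      _ ≤ Real.exp (|v * t ^ 2 / 2| / n) ^ n := by
          gcongr
          rw [add_comm]
          exact Real.add_one_le_exp _
      _ ≤ Real.exp (|v * t ^ 2 / 2|) := by
          rw [← Real.exp_nat_mul]
          rcases eq_or_ne n 0 with rfl | hn
          · simp
          · have : (n : ℝ) ≠ 0 := by exact_mod_cast hn
            rw [mul_div_cancel₀ _ this]
  obtain ⟨C, hC⟩ := ((isBigO_phaseMatrix_mulVec_sub hP ha hb).comp_tendsto hθ).bound
  have hlim0 : Tendsto (fun n : ℕ => Real.exp (|v * t ^ 2 / 2|) * C * t ^ 2 * |t / √n|) atTop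
      (𝓝 0) := by
    simpa using (hθ.abs).const_mul (Real.exp (|v * t ^ 2 / 2|) * C * t ^ 2)
  have hdiff : Tendsto (fun n : ℕ => (phaseMatrix P f (t / √n) ^ n) *ᵥ h (t / √n) -
      lam n ^ n • h (t / √n)) atTop (𝓝 0) := by
    refine squeeze_zero_norm' ?_ hlim0
    filter_upwards [hC, eventually_gt_atTop 0] with n hn hn0
    have hn0' : (0 : ℝ) < n := by exact_mod_cast hn0
    have hsq : (t / √n) ^ 2 = t ^ 2 / n := by rw [div_pow, Real.sq_sqrt hn0'.le]
    have hl : (1 - ((t / √n : ℝ) : ℂ) ^ 2 * v / 2) = lam n := by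
      rw [← Complex.ofReal_pow, hsq]
      simp only [hlam]
      push_cast
      ring
    simp only [Function.comp, hl] at hn
    refine (norm_pow_mulVec_sub_pow_smul_le (norm_phaseMatrix_pow_mulVec_le hP f _)
      (hlamK n) _).trans ?_
    calc n * (Real.exp (|v * t ^ 2 / 2|) * _)
        ≤ n * (Real.exp (|v * t ^ 2 / 2|) * (C * ‖(t / √n) ^ 3‖)) := by gcongr
      _ = Real.exp (|v * t ^ 2 / 2|) * C * t ^ 2 * |t / √n| := by
        rw [pow_succ (t / √n) 2, norm_mul, hsq, Real.norm_eq_abs, Real.norm_eq_abs,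
          abs_of_nonneg (show 0 ≤ t ^ 2 / (n : ℝ) by positivity)]
        field_simp
  have hone : Tendsto (fun n : ℕ => (phaseMatrix P f (t / √n) ^ n) *ᵥ (1 - h (t / √n))) atTop
      (𝓝 0) := by
    refine squeeze_zero_norm (fun n => norm_phaseMatrix_pow_mulVec_le hP f _ n _) ?_
    simpa using (hh1.const_sub 1).norm
  have hmain : Tendsto (fun n : ℕ => (phaseMatrix P f (t / √n) ^ n) *ᵥ (1 : S → ℂ)) atTop
      (𝓝 (Complex.exp (-(v * t ^ 2 / 2)) • 1)) := by
    have := (hdiff.add hone).add (hlamn.smul hh1)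
    simp only [zero_add] at this
    refine this.congr fun n => ?_
    rw [mulVec_sub]
    abel
  have hsum := tendsto_finsetSum univ fun s _ =>
    (tendsto_pi_nhds.1 hmain s).const_mul (π s : ℂ)
  convert hsum using 2
  have h1 : ∑ s, (π s : ℂ) = 1 := by exact_mod_cast hπ1
  simp [← sum_mul, h1]

end Tilted

section Chain

open Matrix

variable {S : Type*} [Fintype S] [DecidableEq S] {P : Matrix S S ℝ} {π f : S → ℝ}

lemma tendsto_sum_phaseMatrix_pow_of_primitive (hP : P ∈ rowStochastic ℝ S)
    (hprim : ∃ m : ℕ, 1 ≤ m ∧ ∀ i j, 0 < (P ^ m) i j)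
    (hπ0 : ∀ s, 0 ≤ π s) (hπ1 : ∑ s, π s = 1) (hstat : π ᵥ* P = π) (hf : π ⬝ᵥ f = 0)
    (t : ℝ) :
    Tendsto (fun n : ℕ => ∑ s, (π s : ℂ) * ((phaseMatrix P f (t / √n) ^ n) *ᵥ 1) s) atTop
      (𝓝 (Complex.exp (-(((π ⬝ᵥ (f * f) + 2 * π ⬝ᵥ (f * ∑' m : ℕ, (P ^ (m + 1)) *ᵥ f) : ℝ) : ℂ)
        * t ^ 2 / 2)))) := by
  have hs := summable_pow_mulVec_of_primitive hP hprim hπ0 hπ1 hstat hf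
  have ha := tsum_pow_mulVec_eq_add hs
  rw [← mulVec_tsum_pow_mulVec hs]
  set a := ∑' m : ℕ, (P ^ m) *ᵥ f
  set v := π ⬝ᵥ (f * f) + 2 * π ⬝ᵥ (f * (P *ᵥ a)) with hv
  set u : S → ℝ := fun s => v / 2 - f s * (P *ᵥ a) s - f s ^ 2 / 2 with hu
  have hπu : π ⬝ᵥ u = 0 := by
    have : π ⬝ᵥ u = (∑ s, π s) * (v / 2) - π ⬝ᵥ (f * (P *ᵥ a)) - π ⬝ᵥ (f * f) / 2 := by
      simp only [dotProduct, hu, Pi.mul_apply, sum_mul, sum_div, ← sum_sub_distrib]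
      exact sum_congr rfl fun s _ => by ring
    rw [this, hπ1, hv]
    ring
  have hb := tsum_pow_mulVec_eq_add
    (summable_pow_mulVec_of_primitive hP hprim hπ0 hπ1 hstat hπu)
  set b := ∑' m : ℕ, (P ^ m) *ᵥ u
  refine tendsto_sum_phaseMatrix_pow hP hπ1 (a := a) (b := b) (fun s => congrFun ha s)
    (fun s => ?_) t
  have := congrFun hb s
  simp only [Pi.add_apply, hu] at this ⊢
  linarith

lemma integral_prod_exp_eq_sum_phaseMatrix_pow [MeasurableSpace S] [MeasurableSingletonClass S]
    {Ω : Type*} [MeasurableSpace Ω] {𝔪 : Measure Ω} [IsProbabilityMeasure 𝔪]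
    (hP : P ∈ rowStochastic ℝ S) (hπ0 : ∀ s, 0 ≤ π s)
    {Z : ℕ → Ω → S} (hZm : ∀ l, Measurable (Z l))
    (hZ : ∀ (n : ℕ) (s : Fin (n + 1) → S),
      𝔪 {ω | ∀ l : Fin (n + 1), Z l.1 ω = s l} =
        ENNReal.ofReal (π (s 0) * ∏ l : Fin n, P (s l.castSucc) (s l.succ)))
    (f : S → ℝ) (θ : ℝ) (n : ℕ) :
    ∫ ω, ∏ l ∈ range (n + 1), Complex.exp (θ * f (Z l ω) * Complex.I) ∂𝔪 =
      ∑ x, (π x : ℂ) * ((phaseMatrix P f θ ^ (n + 1)) *ᵥ 1) x := by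
  set W : Ω → Fin (n + 1) → S := fun ω l => Z l ω with hW
  have hWm : Measurable W := measurable_pi_lambda _ fun l => hZm l
  set G : (Fin (n + 1) → S) → ℂ := fun s => ∏ l, Complex.exp (θ * f (s l) * Complex.I) with hG
  have hprob : IsProbabilityMeasure (𝔪.map W) := Measure.isProbabilityMeasure_map hWm.aemeasurable
  have h1 : ∫ ω, ∏ l ∈ range (n + 1), Complex.exp (θ * f (Z l ω) * Complex.I) ∂𝔪 =
      ∫ s, G s ∂(𝔪.map W) := by
    rw [integral_map hWm.aemeasurable (measurable_of_finite G).aestronglyMeasurable]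
    simp only [hG, hW, prod_range]
  rw [h1, integral_fintype Integrable.of_finite, ← sum_path_eq_phaseMatrix_pow hP]
  refine sum_congr rfl fun s _ => ?_
  have h2 : (𝔪.map W).real {s} = π (s 0) * ∏ l : Fin n, P (s l.castSucc) (s l.succ) := by
    have h3 : W ⁻¹' {s} = {ω | ∀ l : Fin (n + 1), Z l.1 ω = s l} := by
      ext ω
      simp [hW, funext_iff]
    rw [map_measureReal_apply hWm (measurableSet_singleton s), h3, measureReal_def, hZ,
      ENNReal.toReal_ofReal]
    exact mul_nonneg (hπ0 _) (prod_nonneg fun _ _ => hP.1 _ _)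
  rw [h2, Complex.real_smul]
  push_cast
  rfl

lemma sum_mul_indicator_sub_mul (k : S) (g : S → ℝ) :
    π ⬝ᵥ ((fun s => (if s = k then (1 : ℝ) else 0) - π k) * g) = π k * (g k - π ⬝ᵥ g) := by
  simp [dotProduct, sub_mul, mul_sub, sum_sub_distrib, mul_sum, mul_left_comm]

lemma pow_mulVec_indicator_sub (hP : P ∈ rowStochastic ℝ S) (k s : S) (c : ℝ) (m : ℕ) :
    ((P ^ m) *ᵥ (fun s => (if s = k then (1 : ℝ) else 0) - c)) s = (P ^ m) s k - c := by
  simp [mulVec, dotProduct, mul_sub, sum_sub_distrib, ← sum_mul,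
    sum_row_of_mem_rowStochastic (pow_mem hP m)]

end Chain

/-- scalar CLT for the empirical measure of a stationary Markov
chain with primitive transition matrix: with
`U_{n,k} = √n ((1/n) ∑_{l=1}^n 1{Z_l = k} − π_k)`, the series
`σ_k² = π_k(1 − π_k) + 2 ∑_{m≥1} π_k((P^m)_{kk} − π_k)` converges, `σ_k² ≥ 0`,
and `U_{n,k}` converges in distribution to `N(0, σ_k²)`. Convergence in
distribution is expressed by convergence of integrals of all bounded continuous
test functions. Here `Z l` denotes `Z_{l+1}`. -/
theorem stmt_8 {S : Type*} [Fintype S] [DecidableEq S]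
    [MeasurableSpace S] [MeasurableSingletonClass S]
    {Ω : Type*} [MeasurableSpace Ω] (𝔪 : Measure Ω) [IsProbabilityMeasure 𝔪]
    (P : Matrix S S ℝ)
    (hP0 : ∀ i j, 0 ≤ P i j) (hP1 : ∀ i, ∑ j, P i j = 1)
    (hprim : ∃ m : ℕ, 1 ≤ m ∧ ∀ i j, 0 < (P ^ m) i j)
    (π : S → ℝ)
    (hπ0 : ∀ s, 0 ≤ π s) (hπ1 : ∑ s, π s = 1)
    (hstat : ∀ j, ∑ i, π i * P i j = π j)
    (Z : ℕ → Ω → S) (hZm : ∀ l, Measurable (Z l))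
    (hZ : ∀ (n : ℕ) (s : Fin (n + 1) → S),
      𝔪 {ω | ∀ l : Fin (n + 1), Z l.1 ω = s l} =
        ENNReal.ofReal (π (s 0) * ∏ l : Fin n, P (s l.castSucc) (s l.succ)))
    (k : S)
    (U : ℕ → Ω → ℝ)
    (hU : ∀ n ω, U n ω = Real.sqrt n *
      ((1 / (n : ℝ)) * (∑ l ∈ Finset.range n, if Z l ω = k then (1 : ℝ) else 0) - π k)) :
    Summable (fun m : ℕ => π k * ((P ^ (m + 1)) k k - π k)) ∧
    0 ≤ π k * (1 - π k) + 2 * ∑' m : ℕ, π k * ((P ^ (m + 1)) k k - π k) ∧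
    ∀ f : BoundedContinuousFunction ℝ ℝ,
      Tendsto (fun n => ∫ ω, f (U n ω) ∂𝔪) atTop
        (𝓝 (∫ x, f x ∂(gaussianReal 0
          (Real.toNNReal
            (π k * (1 - π k) + 2 * ∑' m : ℕ, π k * ((P ^ (m + 1)) k k - π k)))))) := by
  have hP : P ∈ Matrix.rowStochastic ℝ S := Matrix.mem_rowStochastic_iff_sum.2 ⟨hP0, hP1⟩
  have hst : Matrix.vecMul π P = π := funext hstat
  set f : S → ℝ := fun s => (if s = k then (1 : ℝ) else 0) - π k with hf
  have hπf : dotProduct π f = 0 := by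
    simp [hf, dotProduct, mul_sub, sum_sub_distrib, ← sum_mul, hπ1]
  have hs := summable_pow_mulVec_of_primitive hP hprim hπ0 hπ1 hst hπf
  have hs1 : Summable fun m : ℕ => Matrix.mulVec (P ^ (m + 1)) f := (summable_nat_add_iff 1).2 hs
  have hterm (m : ℕ) : Matrix.mulVec (P ^ (m + 1)) f k = (P ^ (m + 1)) k k - π k :=
    pow_mulVec_indicator_sub hP k k (π k) (m + 1)
  have hsk : Summable fun m : ℕ => (P ^ (m + 1)) k k - π k := by
    simpa only [hterm] using Pi.summable.1 hs1 k
  have hvar : dotProduct π (f * f) +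
        2 * dotProduct π (f * ∑' m : ℕ, Matrix.mulVec (P ^ (m + 1)) f) =
      π k * (1 - π k) + 2 * ∑' m : ℕ, π k * ((P ^ (m + 1)) k k - π k) := by
    have h0 : dotProduct π (∑' m : ℕ, Matrix.mulVec (P ^ (m + 1)) f) = 0 := by
      rw [← mulVec_tsum_pow_mulVec hs, Matrix.dotProduct_mulVec, hst,
        dotProduct_tsum_pow_mulVec_eq_zero hst hπf hs]
    rw [sum_mul_indicator_sub_mul k, sum_mul_indicator_sub_mul k, h0, hπf,
      tsum_apply hs1, tsum_mul_left]
    simp only [hterm]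
    simp [hf]
  set v : ℝ := π k * (1 - π k) + 2 * ∑' m : ℕ, π k * ((P ^ (m + 1)) k k - π k)
  have hUm (n : ℕ) : Measurable (U n) := by
    have h : Measurable fun ω => ∑ l ∈ Finset.range n, if Z l ω = k then (1 : ℝ) else 0 :=
      Finset.measurable_sum _ fun l _ =>
        (measurable_of_finite fun s : S => if s = k then (1 : ℝ) else 0).comp (hZm l)
    rw [funext (hU n)]
    fun_prop
  have hprob (n : ℕ) : IsProbabilityMeasure (𝔪.map (U n)) :=
    Measure.isProbabilityMeasure_map (hUm n).aemeasurable
  have hchar (t : ℝ) : Tendsto (fun n => charFun (𝔪.map (U n)) t) atTop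
      (𝓝 (Complex.exp (-((v : ℂ) * t ^ 2 / 2)))) := by
    have h := tendsto_sum_phaseMatrix_pow_of_primitive hP hprim hπ0 hπ1 hst hπf t
    rw [hvar] at h
    refine h.congr' ?_
    filter_upwards [eventually_ge_atTop 1] with n hn
    obtain ⟨n, rfl⟩ := Nat.exists_eq_add_of_le' hn
    rw [← integral_prod_exp_eq_sum_phaseMatrix_pow hP hπ0 hZm hZ, charFun_apply_real,
      integral_map (hUm _).aemeasurable (by fun_prop)]
    refine integral_congr_ae (Eventually.of_forall fun ω => ?_)
    simp only [← Complex.exp_sum, ← sum_mul, ← mul_sum]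
    congr 2
    rw [← Complex.ofReal_sum, ← Complex.ofReal_mul, ← Complex.ofReal_mul, hU]
    congr 1
    have hpos : (0 : ℝ) < ((n + 1 : ℕ) : ℝ) := by positivity
    have hsq : √((n + 1 : ℕ) : ℝ) ≠ 0 := (Real.sqrt_pos.2 hpos).ne'
    simp only [hf, sum_sub_distrib, sum_const, card_range, nsmul_eq_mul]
    rw [div_mul_eq_mul_div, div_eq_iff hsq]
    have hmul := Real.mul_self_sqrt hpos.le
    calc t * (_ - ((n + 1 : ℕ) : ℝ) * π k)
        = t * (((n + 1 : ℕ) : ℝ) * (1 / ((n + 1 : ℕ) : ℝ) *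
            (∑ l ∈ range (n + 1), if Z l ω = k then (1 : ℝ) else 0) - π k)) := by
          field_simp
      _ = _ := by
          generalize 1 / ((n + 1 : ℕ) : ℝ) * (_ : ℝ) - π k = x
          linear_combination (-(t * x)) * hmul
  have hv0 : 0 ≤ v := by
    have h := le_of_tendsto (hchar 1).norm
      (Eventually.of_forall fun n => norm_charFun_le_one (μ := 𝔪.map (U n)) 1)
    rw [Complex.norm_exp] at h
    have h2 : (-((v : ℂ) * ((1 : ℝ) : ℂ) ^ 2 / 2)).re = -(v / 2) := by
      have : (-((v : ℂ) * ((1 : ℝ) : ℂ) ^ 2 / 2)) = ((-(v / 2) : ℝ) : ℂ) := by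
        push_cast
        ring
      rw [this, Complex.ofReal_re]
    rw [h2, Real.exp_le_one_iff] at h
    linarith
  refine ⟨hsk.mul_left _, hv0, fun g => ?_⟩
  set μ : ℕ → ProbabilityMeasure ℝ := fun n => ⟨𝔪.map (U n), hprob n⟩
  set ν : ProbabilityMeasure ℝ := ⟨gaussianReal 0 v.toNNReal, inferInstance⟩
  have hlim : Tendsto μ atTop (𝓝 ν) := by
    refine ProbabilityMeasure.tendsto_iff_tendsto_charFun.2 fun t => ?_
    have h : charFun (ν : Measure ℝ) t = Complex.exp (-((v : ℂ) * t ^ 2 / 2)) := by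
      change charFun (gaussianReal 0 v.toNNReal) t = _
      rw [charFun_gaussianReal]
      simp [max_eq_left hv0]
    rw [h]
    exact hchar t
  refine (ProbabilityMeasure.tendsto_iff_forall_integral_tendsto.1 hlim g).congr fun n => ?_
  exact integral_map (hUm n).aemeasurable g.continuous.measurable.aestronglyMeasurable
end
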